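/- Suppose X* is a local minimizer of the KS minimization problem (with the special exchange correlation functional) such that Λ* := (X*)ᵀH(X*)X* is a diagonal matrix, and let I* := { i : ρ_i(X*) ≠ 0 }. If the gap assumption holds at H(X*) with a constant δ satisfying δ > 2(‖L†‖₂ − γ/3), then H_{I*I*}(X*) X*_{I*} = X*_{I*} Λ* and (X*_{I*})ᵀ X*_{I*} = I, and the diagonal entries of Λ* are exactly the p smallest eigenvalues of the principal submatrix H_{I*I*}(X*). Here X*_{I*} denotes the submatrix of rows of X* indexed by I*, and H_{I*I*}(X*) the principal submatrix of H(X*) with rows and columns indexed by I*. -/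

import Mathlib

open Matrix Filter
open scoped Classical

/-- Spectral (ℓ² operator) norm of a real matrix. -/
noncomputable def specNorm {m k : ℕ} (A : Matrix (Fin m) (Fin k) ℝ) : ℝ :=
  ‖LinearMap.toContinuousLinearMap (Matrix.toEuclideanLin A)‖

/-- Eigenvalues of a real symmetric matrix, sorted in ascending order
(junk value `0` if the matrix is not symmetric). -/
noncomputable def eig {n : ℕ} (A : Matrix (Fin n) (Fin n) ℝ) : Fin n → ℝ :=
  if h : A.IsHermitian then h.eigenvalues ∘ (Tuple.sort h.eigenvalues) else 0

/-- Charge density `ρ(X) = diag(XXᵀ)`. -/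
noncomputable def rhoX {ι : Type*} [Fintype ι] {p : ℕ} (X : Matrix ι (Fin p) ℝ) : ι → ℝ :=
  fun i => ∑ j, X i j ^ 2

/-- KS total energy with the special exchange correlation functional
`eᵀε_xc(ρ) = −(3/4)γ ρᵀρ^{1/3}`. -/
noncomputable def En {ι : Type*} [Fintype ι] {p : ℕ} (L Vion Ld : Matrix ι ι ℝ) (γ : ℝ)
    (X : Matrix ι (Fin p) ℝ) : ℝ :=
  (1 / 4) * Matrix.trace (Xᵀ * L * X) + (1 / 2) * Matrix.trace (Xᵀ * Vion * X)
    + (1 / 4) * (rhoX X ⬝ᵥ Ld.mulVec (rhoX X))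
    - (3 / 8) * γ * (rhoX X ⬝ᵥ fun i => (rhoX X i) ^ ((1 : ℝ) / 3))

/-- KS Hamiltonian with the special exchange correlation functional:
`H(X) = (1/2)L + V_ion + Diag(L†ρ) − γ Diag(ρ^{1/3})`. -/
noncomputable def HXmat {ι : Type*} [Fintype ι] [DecidableEq ι] {p : ℕ}
    (L Vion Ld : Matrix ι ι ℝ) (γ : ℝ) (X : Matrix ι (Fin p) ℝ) : Matrix ι ι ℝ :=
  (1 / 2 : ℝ) • L + Vion + Matrix.diagonal (Ld.mulVec (rhoX X))
    - γ • Matrix.diagonal (fun i => (rhoX X i) ^ ((1 : ℝ) / 3))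

lemma eig_monotone {m : ℕ} {A : Matrix (Fin m) (Fin m) ℝ} (hA : A.IsHermitian) :
    Monotone (eig A) := by
  simp only [eig, dif_pos hA]
  exact Tuple.monotone_sort _

/-- Spectral decomposition with the sorted eigenvalues. -/
lemma exists_orthogonal_diagonalization {m : ℕ} {A : Matrix (Fin m) (Fin m) ℝ}
    (hA : A.IsHermitian) :
    ∃ B : Matrix (Fin m) (Fin m) ℝ, B * Bᵀ = 1 ∧ A = B * diagonal (eig A) * Bᵀ := by
  set σ := Tuple.sort hA.eigenvalues
  set V : Matrix (Fin m) (Fin m) ℝ := hA.eigenvectorUnitary.1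
  have hV : V * Vᵀ = 1 := by
    have := (Matrix.mem_unitaryGroup_iff).1 hA.eigenvectorUnitary.2
    simpa [star_eq_conjTranspose, conjTranspose_eq_transpose_of_trivial] using this
  have hspec : A = V * diagonal hA.eigenvalues * Vᵀ := by
    have := hA.spectral_theorem
    rw [Unitary.conjStarAlgAut_apply] at this
    simpa [star_eq_conjTranspose, conjTranspose_eq_transpose_of_trivial, Function.comp_def]
      using this
  have heig : eig A = hA.eigenvalues ∘ σ := by rw [eig, dif_pos hA]
  refine ⟨V.submatrix id σ, ?_, ?_⟩
  · rw [transpose_submatrix, submatrix_mul_equiv, hV]; simp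
  · have hd : diagonal (eig A) = (diagonal hA.eigenvalues).submatrix σ σ := by
      rw [heig, submatrix_diagonal_equiv]
    rw [hd, transpose_submatrix, submatrix_mul_equiv, submatrix_mul_equiv, ← hspec]; simp

/-- The quadratic form and the squared norm in an eigenbasis. -/
lemma quadForm_eq_sum_eig {m : ℕ} {A B : Matrix (Fin m) (Fin m) ℝ}
    (hB : B * Bᵀ = 1) (hAB : A = B * diagonal (eig A) * Bᵀ) (x : Fin m → ℝ) :
    x ⬝ᵥ A *ᵥ x = ∑ j, eig A j * (Bᵀ *ᵥ x) j ^ 2 ∧ x ⬝ᵥ x = ∑ j, (Bᵀ *ᵥ x) j ^ 2 := by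
  constructor
  · conv_lhs => rw [hAB]
    rw [← mulVec_mulVec, ← mulVec_mulVec, dotProduct_mulVec, ← mulVec_transpose]
    simp only [dotProduct, mulVec_diagonal]
    exact Finset.sum_congr rfl fun j _ => by ring
  · have h : x ⬝ᵥ x = (Bᵀ *ᵥ x) ⬝ᵥ (Bᵀ *ᵥ x) := by
      rw [dotProduct_mulVec, ← mulVec_transpose, mulVec_mulVec, transpose_transpose, hB,
        one_mulVec]
    rw [h]
    simp only [dotProduct, sq]

/-- Upper half of the Courant–Fischer principle: a compression of `A` to more than `k` orthonormal
directions that is diagonal with entries at most `a` forces `λ_k ≤ a`. -/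
lemma eig_le_of_compression {m : ℕ} {A : Matrix (Fin m) (Fin m) ℝ} (hA : A.IsHermitian)
    {κ : Type*} [Fintype κ] [DecidableEq κ] {U : Matrix (Fin m) κ ℝ} (hU : Uᵀ * U = 1)
    {d : κ → ℝ} (hUA : Uᵀ * A * U = diagonal d) {a : ℝ} (hd : ∀ j, d j ≤ a)
    (k : Fin m) (hk : (k : ℕ) < Fintype.card κ) : eig A k ≤ a := by
  obtain ⟨B, hB, hAB⟩ := exists_orthogonal_diagonalization hA
  let g : (κ → ℝ) →ₗ[ℝ] ({j : Fin m // j < k} → ℝ) :=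
    (LinearMap.funLeft ℝ ℝ Subtype.val) ∘ₗ (Bᵀ * U).mulVecLin
  have hker : LinearMap.ker g ≠ ⊥ := by
    apply LinearMap.ker_ne_bot_of_finrank_lt
    rwa [Module.finrank_fintype_fun_eq_card, Module.finrank_fintype_fun_eq_card,
      Fintype.card_of_subtype (Finset.Iio k) (by simp), Fin.card_Iio]
  obtain ⟨c, hc, hc0⟩ := Submodule.exists_mem_ne_zero_of_ne_bot hker
  have hcz : ∀ j < k, (Bᵀ *ᵥ (U *ᵥ c)) j = 0 := fun j hj => by
    rw [mulVec_mulVec]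
    exact congrFun (LinearMap.mem_ker.1 hc) ⟨j, hj⟩
  have hnorm : (U *ᵥ c) ⬝ᵥ (U *ᵥ c) = ∑ j, c j ^ 2 := by
    rw [dotProduct_mulVec, ← mulVec_transpose, mulVec_mulVec, hU, one_mulVec]
    simp only [dotProduct, sq]
  have hq : (U *ᵥ c) ⬝ᵥ A *ᵥ (U *ᵥ c) = ∑ j, d j * c j ^ 2 := by
    rw [dotProduct_comm, dotProduct_mulVec, ← mulVec_transpose, mulVec_mulVec, mulVec_mulVec, hUA]
    simp only [dotProduct, mulVec_diagonal]
    exact Finset.sum_congr rfl fun j _ => by ring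
  obtain ⟨h1, h2⟩ := quadForm_eq_sum_eig hB hAB (U *ᵥ c)
  have hle : eig A k * ∑ j, c j ^ 2 ≤ a * ∑ j, c j ^ 2 := by
    calc eig A k * ∑ j, c j ^ 2 = ∑ j, eig A k * (Bᵀ *ᵥ (U *ᵥ c)) j ^ 2 := by
          rw [← hnorm, h2, Finset.mul_sum]
      _ ≤ ∑ j, eig A j * (Bᵀ *ᵥ (U *ᵥ c)) j ^ 2 := by
          refine Finset.sum_le_sum fun j _ => ?_
          rcases lt_or_ge j k with hj | hj
          · simp [hcz j hj]
          · exact mul_le_mul_of_nonneg_right (eig_monotone hA hj) (sq_nonneg _)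
      _ = ∑ j, d j * c j ^ 2 := by rw [← h1, hq]
      _ ≤ a * ∑ j, c j ^ 2 := by
          rw [Finset.mul_sum]
          exact Finset.sum_le_sum fun j _ => mul_le_mul_of_nonneg_right (hd j) (sq_nonneg _)
  have hpos : 0 < ∑ j, c j ^ 2 := by
    obtain ⟨j, hj⟩ := Function.ne_iff.1 hc0
    exact Finset.sum_pos' (fun _ _ => sq_nonneg _) ⟨j, Finset.mem_univ _, sq_pos_of_ne_zero hj⟩
  exact le_of_mul_le_mul_right hle hpos

/-- Lower half of the Courant–Fischer principle. -/
lemma le_eig_of_orthogonal {m : ℕ} {A : Matrix (Fin m) (Fin m) ℝ} (hA : A.IsHermitian)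
    {κ : Type*} [Fintype κ] {U : Matrix (Fin m) κ ℝ} {a : ℝ}
    (hlow : ∀ y : Fin m → ℝ, Uᵀ *ᵥ y = 0 → a * (y ⬝ᵥ y) ≤ y ⬝ᵥ A *ᵥ y)
    (k : Fin m) (hk : Fintype.card κ ≤ k) : a ≤ eig A k := by
  obtain ⟨B, hB, hAB⟩ := exists_orthogonal_diagonalization hA
  let g : (Fin m → ℝ) →ₗ[ℝ] (κ → ℝ) × ({j : Fin m // k < j} → ℝ) :=
    Uᵀ.mulVecLin.prod ((LinearMap.funLeft ℝ ℝ Subtype.val) ∘ₗ Bᵀ.mulVecLin)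
  have hker : LinearMap.ker g ≠ ⊥ := by
    apply LinearMap.ker_ne_bot_of_finrank_lt
    have := k.2
    rw [Module.finrank_prod, Module.finrank_fintype_fun_eq_card,
      Module.finrank_fintype_fun_eq_card, Module.finrank_fintype_fun_eq_card,
      Fintype.card_of_subtype (Finset.Ioi k) (by simp), Fin.card_Ioi, Fintype.card_fin]
    omega
  obtain ⟨x, hx, hx0⟩ := Submodule.exists_mem_ne_zero_of_ne_bot hker
  have hgx : Uᵀ *ᵥ x = 0 ∧ ∀ j, k < j → (Bᵀ *ᵥ x) j = 0 := by
    have h := LinearMap.mem_ker.1 hx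
    refine ⟨congrArg Prod.fst h, fun j hj => congrFun (congrArg Prod.snd h) ⟨j, hj⟩⟩
  obtain ⟨h1, h2⟩ := quadForm_eq_sum_eig hB hAB x
  have hle : a * (x ⬝ᵥ x) ≤ eig A k * (x ⬝ᵥ x) := by
    refine (hlow x hgx.1).trans ?_
    rw [h1, h2, Finset.mul_sum]
    refine Finset.sum_le_sum fun j _ => ?_
    rcases lt_or_ge k j with hj | hj
    · simp [hgx.2 j hj]
    · exact mul_le_mul_of_nonneg_right (eig_monotone hA hj) (sq_nonneg _)
  exact le_of_mul_le_mul_right hle (by simpa using (dotProduct_star_self_pos_iff (v := x)).2 hx0)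

/-- If the orthonormal columns of `U` are eigenvectors of `A` with eigenvalues `d`, and `A ≥ a` on
their orthogonal complement, then `a ≤ λ_k` as soon as at most `k` of the `d j` are below `a`. -/
lemma le_eig_of_eigenframe {m : ℕ} {A : Matrix (Fin m) (Fin m) ℝ} (hA : A.IsHermitian)
    {κ : Type*} [Fintype κ] [DecidableEq κ] {U : Matrix (Fin m) κ ℝ} (hU : Uᵀ * U = 1)
    {d : κ → ℝ} (hAU : A * U = U * diagonal d) {a : ℝ}
    (hlow : ∀ y : Fin m → ℝ, Uᵀ *ᵥ y = 0 → a * (y ⬝ᵥ y) ≤ y ⬝ᵥ A *ᵥ y)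
    (k : Fin m) (hk : Fintype.card {j // d j < a} ≤ k) : a ≤ eig A k := by
  refine le_eig_of_orthogonal hA (U := U.submatrix id (Subtype.val : {j // d j < a} → κ))
    (fun y hy => ?_) k hk
  set c := Uᵀ *ᵥ y with hc
  have hc0 : ∀ j, d j < a → c j = 0 := fun j hj => congrFun hy ⟨j, hj⟩
  set z := y - U *ᵥ c with hz
  have hUz : Uᵀ *ᵥ z = 0 := by
    rw [hz, mulVec_sub, mulVec_mulVec, hU, one_mulVec, hc, sub_self]
  have hy' : y = U *ᵥ c + z := by simp [hz]
  have hUtA : Uᵀ * A = diagonal d * Uᵀ := by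
    have := congrArg transpose hAU
    rw [transpose_mul, transpose_mul, diagonal_transpose] at this
    rwa [← conjTranspose_eq_transpose_of_trivial A, hA.eq] at this
  have hUv : ∀ v, (U *ᵥ c) ⬝ᵥ v = c ⬝ᵥ (Uᵀ *ᵥ v) := fun v => by
    rw [dotProduct_mulVec, ← mulVec_transpose, transpose_transpose]
  have hzU : z ⬝ᵥ (U *ᵥ c) = 0 := by rw [dotProduct_comm, hUv, hUz, dotProduct_zero]
  have hnorm : y ⬝ᵥ y = ∑ j, c j ^ 2 + z ⬝ᵥ z := by
    conv_lhs => rw [hy', dotProduct_add, add_dotProduct, add_dotProduct, hUv, hUv, hUz, hzU,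
      mulVec_mulVec, hU, one_mulVec]
    simp [dotProduct, sq]
  have hzAU : z ⬝ᵥ A *ᵥ (U *ᵥ c) = 0 := by
    rw [mulVec_mulVec, hAU, ← mulVec_mulVec, dotProduct_mulVec, ← mulVec_transpose, hUz,
      zero_dotProduct]
  have hq : y ⬝ᵥ A *ᵥ y = ∑ j, d j * c j ^ 2 + z ⬝ᵥ A *ᵥ z := by
    conv_lhs => rw [hy', mulVec_add, dotProduct_add, add_dotProduct, add_dotProduct, hUv, hUv,
      hzAU, mulVec_mulVec z, hUtA, ← mulVec_mulVec z, hUz, mulVec_mulVec, mulVec_mulVec, hUtA,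
      Matrix.mul_assoc, hU]
    simp only [Matrix.mul_one, mulVec_zero, dotProduct_zero, add_zero, zero_add]
    simp only [dotProduct, mulVec_diagonal]
    congr 1
    exact Finset.sum_congr rfl fun j _ => by ring
  rw [hnorm, hq, mul_add, Finset.mul_sum]
  refine add_le_add (Finset.sum_le_sum fun j _ => ?_) (hlow z hUz)
  rcases lt_or_ge (d j) a with hj | hj
  · simp [hc0 j hj]
  · exact mul_le_mul_of_nonneg_right hj (sq_nonneg _)

lemma card_le_of_orthonormal_columns {m : ℕ} {κ : Type*} [Fintype κ] [DecidableEq κ]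
    {U : Matrix (Fin m) κ ℝ} (hU : Uᵀ * U = 1) : Fintype.card κ ≤ m := by
  have h : (1 : Matrix κ κ ℝ).rank ≤ U.rank := hU ▸ Matrix.rank_mul_le_right Uᵀ U
  rw [rank_one] at h
  simpa using h.trans U.rank_le_card_height

/-- Orthonormal eigenvectors whose eigenvalues bound `A` from below on the orthogonal complement
carry exactly the smallest eigenvalues of `A`. -/
lemma map_eq_map_eig_of_eigenframe {m p : ℕ} {A : Matrix (Fin m) (Fin m) ℝ} (hA : A.IsHermitian)
    {U : Matrix (Fin m) (Fin p) ℝ} (hU : Uᵀ * U = 1)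
    {d : Fin p → ℝ} (hAU : A * U = U * diagonal d)
    (hlow : ∀ y : Fin m → ℝ, Uᵀ *ᵥ y = 0 → ∀ k, d k * (y ⬝ᵥ y) ≤ y ⬝ᵥ A *ᵥ y)
    (hpm : p ≤ m) :
    Finset.univ.val.map d = Finset.univ.val.map fun k => eig A (Fin.castLE hpm k) := by
  set σ := Tuple.sort d
  have hσ : Monotone (d ∘ σ) := Tuple.monotone_sort d
  have key : ∀ k, eig A (Fin.castLE hpm k) = d (σ k) := by
    intro k
    apply le_antisymm
    · let ι : {j // j ≤ k} → Fin p := fun j => σ j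
      have hι : Function.Injective ι := σ.injective.comp Subtype.val_injective
      refine eig_le_of_compression hA (U := U.submatrix id ι) (d := d ∘ ι) ?_ ?_
        (fun j => hσ j.2) _ ?_
      · have : (U.submatrix id ι)ᵀ * U.submatrix id ι = (Uᵀ * U).submatrix ι ι := rfl
        rw [this, hU, submatrix_one _ hι]
      · have : (U.submatrix id ι)ᵀ * A * U.submatrix id ι = (Uᵀ * A * U).submatrix ι ι := rfl
        rw [this, Matrix.mul_assoc, hAU, ← Matrix.mul_assoc, hU, Matrix.one_mul,
          submatrix_diagonal _ _ hι]
      · rw [Fintype.card_of_subtype (Finset.Iic k) (by simp), Fin.card_Iic]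
        exact Nat.lt_succ_self _
    · refine le_eig_of_eigenframe hA hU hAU (fun y hy => hlow y hy _) _ ?_
      have hinj : Function.Injective
          (fun j : {j // d j < d (σ k)} => (⟨σ.symm j, by
            by_contra hj
            have := hσ (not_lt.1 hj)
            simp only [Function.comp, Equiv.apply_symm_apply] at this
            exact absurd j.2 (not_lt.2 this)⟩ : {i // i < k})) := fun i j hij => by
        simpa [Subtype.ext_iff] using hij
      refine (Fintype.card_le_of_injective _ hinj).trans ?_
      rw [Fintype.card_of_subtype (Finset.Iio k) (by simp), Fin.card_Iio]
      rfl
  have hmap : (fun k => eig A (Fin.castLE hpm k)) = d ∘ σ := funext key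
  rw [hmap, ← Multiset.map_map]
  congr 1
  exact (congrArg Finset.val (Finset.map_univ_equiv σ)).symm

/-- The Moore–Penrose inverse of a symmetric matrix is symmetric. -/
lemma transpose_eq_of_moorePenrose {n : ℕ} {L Ld : Matrix (Fin n) (Fin n) ℝ}
    (hL : Lᵀ = L) (hMP1 : L * Ld * L = L) (hMP2 : Ld * L * Ld = Ld)
    (hMP3 : (L * Ld)ᵀ = L * Ld) (hMP4 : (Ld * L)ᵀ = Ld * L) : Ldᵀ = Ld := by
  rw [transpose_mul, hL] at hMP3 hMP4
  have h2 : Ldᵀ * L * Ldᵀ = Ldᵀ := by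
    have := congrArg transpose hMP2
    simpa [transpose_mul, hL, Matrix.mul_assoc] using this
  have hcomm : Ld * L = L * Ld := by
    calc Ld * L = L * Ldᵀ := hMP4.symm
      _ = L * Ld * (L * Ldᵀ) := by rw [← Matrix.mul_assoc, hMP1]
      _ = L * Ld * (Ld * L) := by rw [hMP4]
      _ = Ldᵀ * L * (Ld * L) := by rw [hMP3]
      _ = Ldᵀ * (L * Ld * L) := by simp only [Matrix.mul_assoc]
      _ = L * Ld := by rw [hMP1, hMP3]
  calc Ldᵀ = Ldᵀ * L * Ldᵀ := h2.symm
    _ = L * Ld * Ldᵀ := by rw [hMP3]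
    _ = Ld * (L * Ldᵀ) := by rw [← hcomm, Matrix.mul_assoc]
    _ = Ld := by rw [hMP4, hcomm, ← Matrix.mul_assoc, hMP2]

lemma dotProduct_mulVec_le_specNorm {n : ℕ} (A : Matrix (Fin n) (Fin n) ℝ) (u : Fin n → ℝ) :
    u ⬝ᵥ A *ᵥ u ≤ specNorm A * ∑ i, u i ^ 2 := by
  set T := LinearMap.toContinuousLinearMap (Matrix.toEuclideanLin A)
  set v : EuclideanSpace ℝ (Fin n) := WithLp.toLp 2 u
  have h1 : u ⬝ᵥ A *ᵥ u = inner ℝ v (T v) := by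
    simp [T, v, PiLp.inner_apply, dotProduct, mul_comm]
  have h2 : ∑ i, u i ^ 2 = ‖v‖ ^ 2 := by
    simp [v, EuclideanSpace.norm_sq_eq]
  rw [h1, h2]
  calc inner ℝ v (T v) ≤ ‖v‖ * ‖T v‖ := real_inner_le_norm _ _
    _ ≤ ‖v‖ * (‖T‖ * ‖v‖) := by gcongr; exact T.le_opNorm v
    _ = specNorm A * ‖v‖ ^ 2 := by rw [show specNorm A = ‖T‖ from rfl]; ring

/-- Strong convexity of `t ↦ t^{4/3}` on `[0, 1]`. -/
lemma rpow_four_thirds_strong_convex {r s : ℝ} (hr : 0 ≤ r) (hr1 : r ≤ 1) (hs : 0 ≤ s)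
    (hs1 : s ≤ 1) :
    r * r ^ ((1 : ℝ) / 3) + 4 / 3 * r ^ ((1 : ℝ) / 3) * (s - r) + 2 / 9 * (s - r) ^ 2
      ≤ s * s ^ ((1 : ℝ) / 3) := by
  have hcube : ∀ {x : ℝ}, 0 ≤ x → x = (x ^ ((1 : ℝ) / 3)) ^ 3 := fun {x} hx => by
    rw [← Real.rpow_natCast, ← Real.rpow_mul hx]; norm_num
  set a := r ^ ((1 : ℝ) / 3) with ha
  set b := s ^ ((1 : ℝ) / 3) with hb
  have ha0 : 0 ≤ a := Real.rpow_nonneg hr _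
  have hb0 : 0 ≤ b := Real.rpow_nonneg hs _
  have ha1 : a ≤ 1 := Real.rpow_le_one hr hr1 (by norm_num)
  have hb1 : b ≤ 1 := Real.rpow_le_one hs hs1 (by norm_num)
  rw [hcube hr, hcube hs, ← ha, ← hb]
  have key : 2 / 9 * (b ^ 2 + a * b + a ^ 2) ^ 2 ≤ b ^ 2 + 2 / 3 * (a * b) + 1 / 3 * a ^ 2 := by
    rcases le_total a b with hab | hab
    · have hQ : b ^ 2 + a * b + a ^ 2 ≤ 3 := by nlinarith
      have hQ0 : 0 ≤ b ^ 2 + a * b + a ^ 2 := by positivity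
      nlinarith
    · have hP : 0 ≤ b ^ 2 + 2 / 3 * (a * b) + 1 / 3 * a ^ 2 := by positivity
      have hmul : a ^ 2 * (b ^ 2 + 2 / 3 * (a * b) + 1 / 3 * a ^ 2)
          ≤ b ^ 2 + 2 / 3 * (a * b) + 1 / 3 * a ^ 2 :=
        mul_le_of_le_one_left hP (by nlinarith)
      refine le_trans ?_ hmul
      obtain ⟨t, ht, hat⟩ : ∃ t, 0 ≤ t ∧ a = b + t := ⟨a - b, by linarith, by ring⟩
      have : 0 ≤ t ^ 4 + 6 * b * t ^ 3 + 15 * b ^ 2 * t ^ 2 + 12 * b ^ 3 * t := by positivity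
      rw [hat]
      linarith
  have := mul_le_mul_of_nonneg_left key (sq_nonneg (b - a))
  nlinarith

lemma rhoX_nonneg {n p : ℕ} (X : Matrix (Fin n) (Fin p) ℝ) (i : Fin n) : 0 ≤ rhoX X i :=
  Finset.sum_nonneg fun _ _ => sq_nonneg _

lemma rhoX_le_one {n p : ℕ} {X : Matrix (Fin n) (Fin p) ℝ} (hX : Xᵀ * X = 1) (i : Fin n) :
    rhoX X i ≤ 1 := by
  set P := X * Xᵀ with hP
  have hPP : P * Pᵀ = P := by
    rw [hP, transpose_mul, transpose_transpose, Matrix.mul_assoc, ← Matrix.mul_assoc Xᵀ, hX,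
      Matrix.one_mul]
  have hPi : P i i = rhoX X i := by
    simp [hP, mul_apply, rhoX, sq]
  have h1 : ∑ j, P i j ^ 2 = P i i := by
    conv_rhs => rw [← hPP]
    simp [mul_apply, sq]
  have h2 : P i i ^ 2 ≤ ∑ j, P i j ^ 2 :=
    Finset.single_le_sum (f := fun j => P i j ^ 2) (fun _ _ => sq_nonneg _) (Finset.mem_univ i)
  rw [← hPi]
  nlinarith

lemma trace_transpose_mul_diagonal_mul {n p : ℕ} (Y : Matrix (Fin n) (Fin p) ℝ)
    (v : Fin n → ℝ) : trace (Yᵀ * diagonal v * Y) = ∑ i, v i * rhoX Y i := by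
  simp only [trace, diag, mul_apply (M := Yᵀ * diagonal v), mul_diagonal, transpose_apply, rhoX,
    Finset.mul_sum]
  rw [Finset.sum_comm]
  exact Finset.sum_congr rfl fun i _ => Finset.sum_congr rfl fun j _ => by ring

lemma trace_HXmat {n p : ℕ} (L Vion Ld : Matrix (Fin n) (Fin n) ℝ) (γ : ℝ)
    (X Y : Matrix (Fin n) (Fin p) ℝ) :
    trace (Yᵀ * HXmat L Vion Ld γ X * Y) = 1 / 2 * trace (Yᵀ * L * Y) + trace (Yᵀ * Vion * Y)
      + (rhoX Y ⬝ᵥ Ld *ᵥ rhoX X) - γ * ∑ i, rhoX X i ^ ((1 : ℝ) / 3) * rhoX Y i := by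
  simp only [HXmat, Matrix.mul_add, Matrix.mul_sub, Matrix.add_mul, Matrix.sub_mul, trace_add,
    trace_sub, Matrix.mul_smul, Matrix.smul_mul, trace_smul, smul_eq_mul,
    trace_transpose_mul_diagonal_mul]
  simp only [dotProduct, mul_comm]

/-- The energy lies below its linearization through the Hamiltonian up to a quadratic error in
the density. -/
lemma En_sub_le {n p : ℕ} {L Vion Ld : Matrix (Fin n) (Fin n) ℝ} (hLd : Ldᵀ = Ld)
    {γ : ℝ} (hγ : 0 ≤ γ) {X Y : Matrix (Fin n) (Fin p) ℝ} (hX : Xᵀ * X = 1) (hY : Yᵀ * Y = 1) :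
    En L Vion Ld γ Y - En L Vion Ld γ X
      ≤ 1 / 2 * (trace (Yᵀ * HXmat L Vion Ld γ X * Y) - trace (Xᵀ * HXmat L Vion Ld γ X * X))
        + 1 / 4 * (specNorm Ld - γ / 3) * ∑ i, (rhoX Y i - rhoX X i) ^ 2 := by
  rw [trace_HXmat, trace_HXmat]
  have hspec := dotProduct_mulVec_le_specNorm Ld (rhoX Y - rhoX X)
  have hsymm : rhoX X ⬝ᵥ Ld *ᵥ rhoX Y = rhoX Y ⬝ᵥ Ld *ᵥ rhoX X := by
    rw [dotProduct_mulVec, ← mulVec_transpose, hLd, dotProduct_comm]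
  rw [mulVec_sub, dotProduct_sub, sub_dotProduct, sub_dotProduct, hsymm] at hspec
  simp only [Pi.sub_apply] at hspec
  have hxc : ∑ i, (rhoX X i * rhoX X i ^ ((1 : ℝ) / 3)
      + 4 / 3 * rhoX X i ^ ((1 : ℝ) / 3) * (rhoX Y i - rhoX X i)
      + 2 / 9 * (rhoX Y i - rhoX X i) ^ 2) ≤ ∑ i, rhoX Y i * rhoX Y i ^ ((1 : ℝ) / 3) :=
    Finset.sum_le_sum fun i _ => rpow_four_thirds_strong_convex (rhoX_nonneg X i)
      (rhoX_le_one hX i) (rhoX_nonneg Y i) (rhoX_le_one hY i)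
  have hexp : ∑ i, (rhoX X i * rhoX X i ^ ((1 : ℝ) / 3)
      + 4 / 3 * rhoX X i ^ ((1 : ℝ) / 3) * (rhoX Y i - rhoX X i)
      + 2 / 9 * (rhoX Y i - rhoX X i) ^ 2)
      = ∑ i, rhoX X i * rhoX X i ^ ((1 : ℝ) / 3)
        + 4 / 3 * (∑ i, rhoX X i ^ ((1 : ℝ) / 3) * rhoX Y i
          - ∑ i, rhoX X i ^ ((1 : ℝ) / 3) * rhoX X i)
        + 2 / 9 * ∑ i, (rhoX Y i - rhoX X i) ^ 2 := by
    rw [← Finset.sum_sub_distrib, Finset.mul_sum, Finset.mul_sum, ← Finset.sum_add_distrib,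
      ← Finset.sum_add_distrib]
    exact Finset.sum_congr rfl fun i _ => by ring
  rw [hexp] at hxc
  have hxc' := mul_le_mul_of_nonneg_left hxc (by positivity : 0 ≤ 3 / 8 * γ)
  simp only [En, dotProduct] at hspec ⊢
  linarith

lemma trace_transpose_mul_mul {n p : ℕ} (M : Matrix (Fin n) (Fin n) ℝ)
    (Y : Matrix (Fin n) (Fin p) ℝ) : trace (Yᵀ * M * Y) = ∑ j, Yᵀ j ⬝ᵥ M *ᵥ Yᵀ j := by
  simp only [trace, diag, Matrix.mul_assoc]
  rfl

/-- Rotate column `k` of `X` towards `y` by the angle `t`. -/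
noncomputable def rotateCol {n p : ℕ} (X : Matrix (Fin n) (Fin p) ℝ) (k : Fin p)
    (y : Fin n → ℝ) (t : ℝ) : Matrix (Fin n) (Fin p) ℝ :=
  X.updateCol k (Real.cos t • Xᵀ k + Real.sin t • y)

section rotateCol

variable {n p : ℕ} {X : Matrix (Fin n) (Fin p) ℝ} (k : Fin p) {y : Fin n → ℝ}

lemma rotateCol_zero : rotateCol X k y 0 = X := by
  simp only [rotateCol, Real.cos_zero, Real.sin_zero, one_smul, zero_smul, add_zero]
  exact updateCol_eq_self X k

lemma continuous_rotateCol : Continuous (rotateCol X k y) := by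
  refine continuous_matrix fun i j => ?_
  by_cases hj : j = k
  · subst hj
    simp only [rotateCol, updateCol_self, Pi.add_apply, Pi.smul_apply, smul_eq_mul]
    fun_prop
  · simp only [rotateCol, updateCol_ne hj]
    fun_prop

lemma transpose_rotateCol_self (t : ℝ) :
    (rotateCol X k y t)ᵀ k = Real.cos t • Xᵀ k + Real.sin t • y := by
  ext i
  simp [rotateCol]

lemma transpose_rotateCol_of_ne {j : Fin p} (hj : j ≠ k) (t : ℝ) :
    (rotateCol X k y t)ᵀ j = Xᵀ j := by
  ext i
  simp [rotateCol, updateCol_ne hj]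

lemma dotProduct_transpose_of_orthonormal (hX : Xᵀ * X = 1) (i j : Fin p) :
    Xᵀ i ⬝ᵥ Xᵀ j = (1 : Matrix (Fin p) (Fin p) ℝ) i j := by
  rw [← hX]
  rfl

lemma rotateCol_feasible (hX : Xᵀ * X = 1) (hXy : Xᵀ *ᵥ y = 0) (hy : y ⬝ᵥ y = 1) (t : ℝ) :
    (rotateCol X k y t)ᵀ * rotateCol X k y t = 1 := by
  have hXX := dotProduct_transpose_of_orthonormal hX
  have hXy' : ∀ i, Xᵀ i ⬝ᵥ y = 0 := fun i => congrFun hXy i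
  have hyX : ∀ i, y ⬝ᵥ Xᵀ i = 0 := fun i => by rw [dotProduct_comm, hXy']
  ext a b
  change (rotateCol X k y t)ᵀ a ⬝ᵥ (rotateCol X k y t)ᵀ b = _
  by_cases ha : a = k <;> by_cases hb : b = k
  · subst ha hb
    simp [transpose_rotateCol_self, hXX, hXy', hyX, hy, ← sq]
  · subst ha
    simp [transpose_rotateCol_self, transpose_rotateCol_of_ne _ hb, hXX, hyX, Ne.symm hb]
  · subst hb
    simp [transpose_rotateCol_self, transpose_rotateCol_of_ne _ ha, hXX, hXy', ha]
  · simp [transpose_rotateCol_of_ne _ ha, transpose_rotateCol_of_ne _ hb, hXX]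

lemma trace_rotateCol_sub {M : Matrix (Fin n) (Fin n) ℝ} (hM : Mᵀ = M) (t : ℝ) :
    trace ((rotateCol X k y t)ᵀ * M * rotateCol X k y t) - trace (Xᵀ * M * X)
      = 2 * Real.sin t * Real.cos t * (y ⬝ᵥ M *ᵥ Xᵀ k)
        + Real.sin t ^ 2 * (y ⬝ᵥ M *ᵥ y - Xᵀ k ⬝ᵥ M *ᵥ Xᵀ k) := by
  have hsymm : Xᵀ k ⬝ᵥ M *ᵥ y = y ⬝ᵥ M *ᵥ Xᵀ k := by
    rw [dotProduct_mulVec, ← mulVec_transpose, hM, dotProduct_comm]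
  rw [trace_transpose_mul_mul, trace_transpose_mul_mul, ← Finset.sum_sub_distrib,
    Finset.sum_eq_single k, transpose_rotateCol_self]
  · simp only [mulVec_add, mulVec_smul, dotProduct_add, add_dotProduct,
      dotProduct_smul, smul_dotProduct, smul_eq_mul, hsymm]
    linear_combination (Xᵀ k ⬝ᵥ M *ᵥ Xᵀ k) * Real.sin_sq_add_cos_sq t
  · intro j _ hj
    rw [transpose_rotateCol_of_ne k hj, sub_self]
  · simp

lemma rhoX_rotateCol_sub (t : ℝ) (i : Fin n) :
    rhoX (rotateCol X k y t) i - rhoX X i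
      = Real.sin t * (2 * Real.cos t * (X i k * y i) + Real.sin t * (y i ^ 2 - X i k ^ 2)) := by
  rw [rhoX, rhoX, ← Finset.sum_sub_distrib, Finset.sum_eq_single k]
  · simp only [rotateCol, updateCol_self, Pi.add_apply, Pi.smul_apply, smul_eq_mul,
      transpose_apply]
    linear_combination (X i k ^ 2) * Real.sin_sq_add_cos_sq t
  · intro j _ hj
    rw [rotateCol, updateCol_ne hj, sub_self]
  · simp

end rotateCol

lemma HXmat_isHermitian {n p : ℕ} {L Vion : Matrix (Fin n) (Fin n) ℝ} (hL : L.IsHermitian)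
    (hVion : Vion.IsHermitian) (Ld : Matrix (Fin n) (Fin n) ℝ) (γ : ℝ)
    (X : Matrix (Fin n) (Fin p) ℝ) : (HXmat L Vion Ld γ X).IsHermitian := by
  rw [IsHermitian, conjTranspose_eq_transpose_of_trivial] at *
  simp [HXmat, hL, hVion]

lemma eventually_sin_pos : ∀ᶠ t in nhdsWithin (0 : ℝ) (Set.Ioi 0), 0 < Real.sin t := by
  filter_upwards [Ioo_mem_nhdsGT Real.pi_pos] with t ht
  exact Real.sin_pos_of_mem_Ioo ht

section localMin

variable {n p : ℕ} {L Vion Ld : Matrix (Fin n) (Fin n) ℝ} {γ : ℝ} {X : Matrix (Fin n) (Fin p) ℝ}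

/-- Local minimality tested along the rotation of one column. -/
lemma eventually_rotation_nonneg (hL : L.IsHermitian) (hVion : Vion.IsHermitian)
    (hLd : Ldᵀ = Ld) (hγ : 0 ≤ γ) (hX : Xᵀ * X = 1)
    (hmin : IsLocalMinOn (En L Vion Ld γ) {Y : Matrix (Fin n) (Fin p) ℝ | Yᵀ * Y = 1} X)
    (k : Fin p) {y : Fin n → ℝ} (hXy : Xᵀ *ᵥ y = 0) (hy : y ⬝ᵥ y = 1) :
    ∀ᶠ t in nhdsWithin (0 : ℝ) (Set.Ioi 0),
      0 ≤ 2 * Real.cos t * (y ⬝ᵥ HXmat L Vion Ld γ X *ᵥ Xᵀ k)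
        + Real.sin t * ((y ⬝ᵥ HXmat L Vion Ld γ X *ᵥ y
            - Xᵀ k ⬝ᵥ HXmat L Vion Ld γ X *ᵥ Xᵀ k)
          + 1 / 2 * (specNorm Ld - γ / 3) * ∑ i,
            (2 * Real.cos t * (X i k * y i) + Real.sin t * (y i ^ 2 - X i k ^ 2)) ^ 2) := by
  have hfeas := rotateCol_feasible k hX hXy hy
  have htend : Tendsto (rotateCol X k y) (nhdsWithin 0 (Set.Ioi 0))
      (nhdsWithin X {Y : Matrix (Fin n) (Fin p) ℝ | Yᵀ * Y = 1}) := by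
    refine tendsto_nhdsWithin_iff.2 ⟨?_, Eventually.of_forall hfeas⟩
    have h := (continuous_rotateCol (X := X) (y := y) k).tendsto 0
    rw [rotateCol_zero] at h
    exact h.mono_left nhdsWithin_le_nhds
  filter_upwards [htend.eventually hmin, eventually_sin_pos] with t ht hs
  have hH := HXmat_isHermitian hL hVion Ld γ X
  rw [IsHermitian, conjTranspose_eq_transpose_of_trivial] at hH
  have hE := En_sub_le (L := L) (Vion := Vion) hLd hγ hX (hfeas t)
  rw [trace_rotateCol_sub k hH] at hE
  simp only [rhoX_rotateCol_sub, mul_pow (Real.sin t), ← Finset.mul_sum] at hE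
  refine nonneg_of_mul_nonneg_right (a := Real.sin t) ?_ hs
  linarith

/-- First-order optimality. -/
lemma dotProduct_HXmat_eq_zero (hL : L.IsHermitian) (hVion : Vion.IsHermitian)
    (hLd : Ldᵀ = Ld) (hγ : 0 ≤ γ) (hX : Xᵀ * X = 1)
    (hmin : IsLocalMinOn (En L Vion Ld γ) {Y : Matrix (Fin n) (Fin p) ℝ | Yᵀ * Y = 1} X)
    (k : Fin p) {y : Fin n → ℝ} (hXy : Xᵀ *ᵥ y = 0) (hy : y ⬝ᵥ y = 1) :
    y ⬝ᵥ HXmat L Vion Ld γ X *ᵥ Xᵀ k = 0 := by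
  have key : ∀ z : Fin n → ℝ, Xᵀ *ᵥ z = 0 → z ⬝ᵥ z = 1 →
      0 ≤ z ⬝ᵥ HXmat L Vion Ld γ X *ᵥ Xᵀ k := by
    intro z hXz hz
    have hev := eventually_rotation_nonneg hL hVion hLd hγ hX hmin k hXz hz
    have hcont : Continuous fun t : ℝ => 2 * Real.cos t * (z ⬝ᵥ HXmat L Vion Ld γ X *ᵥ Xᵀ k)
        + Real.sin t * ((z ⬝ᵥ HXmat L Vion Ld γ X *ᵥ z
            - Xᵀ k ⬝ᵥ HXmat L Vion Ld γ X *ᵥ Xᵀ k)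
          + 1 / 2 * (specNorm Ld - γ / 3) * ∑ i,
            (2 * Real.cos t * (X i k * z i) + Real.sin t * (z i ^ 2 - X i k ^ 2)) ^ 2) := by
      fun_prop
    have := ge_of_tendsto ((hcont.tendsto 0).mono_left nhdsWithin_le_nhds) hev
    simpa using this
  have h1 := key y hXy hy
  have h2 := key (-y) (by rw [mulVec_neg, hXy, neg_zero]) (by simpa using hy)
  rw [neg_dotProduct] at h2
  linarith

/-- Second-order optimality. -/
lemma second_order_nonneg (hL : L.IsHermitian) (hVion : Vion.IsHermitian)
    (hLd : Ldᵀ = Ld) (hγ : 0 ≤ γ) (hX : Xᵀ * X = 1)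
    (hmin : IsLocalMinOn (En L Vion Ld γ) {Y : Matrix (Fin n) (Fin p) ℝ | Yᵀ * Y = 1} X)
    (k : Fin p) {y : Fin n → ℝ} (hXy : Xᵀ *ᵥ y = 0) (hy : y ⬝ᵥ y = 1) :
    0 ≤ (y ⬝ᵥ HXmat L Vion Ld γ X *ᵥ y - Xᵀ k ⬝ᵥ HXmat L Vion Ld γ X *ᵥ Xᵀ k)
      + 2 * (specNorm Ld - γ / 3) * ∑ i, (X i k * y i) ^ 2 := by
  have hev := eventually_rotation_nonneg hL hVion hLd hγ hX hmin k hXy hy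
  simp only [dotProduct_HXmat_eq_zero hL hVion hLd hγ hX hmin k hXy hy, mul_zero, zero_add] at hev
  have hcont : Continuous fun t : ℝ => (y ⬝ᵥ HXmat L Vion Ld γ X *ᵥ y
            - Xᵀ k ⬝ᵥ HXmat L Vion Ld γ X *ᵥ Xᵀ k)
          + 1 / 2 * (specNorm Ld - γ / 3) * ∑ i,
            (2 * Real.cos t * (X i k * y i) + Real.sin t * (y i ^ 2 - X i k ^ 2)) ^ 2 := by
    fun_prop
  have h := ge_of_tendsto ((hcont.tendsto 0).mono_left nhdsWithin_le_nhds)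
    ((hev.and eventually_sin_pos).mono fun t ht => nonneg_of_mul_nonneg_right ht.1 ht.2)
  simp only [Real.cos_zero, Real.sin_zero, zero_mul, add_zero, mul_one, mul_pow (2 : ℝ),
    ← Finset.mul_sum] at h
  linarith

/-- The Rayleigh quotient off the span of `X` is bounded below by the entries of `Λ`, up to
the contribution of the density response. -/
lemma le_rayleigh_of_localMin (hL : L.IsHermitian) (hVion : Vion.IsHermitian)
    (hLd : Ldᵀ = Ld) (hγ : 0 ≤ γ) (hX : Xᵀ * X = 1)
    (hmin : IsLocalMinOn (En L Vion Ld γ) {Y : Matrix (Fin n) (Fin p) ℝ | Yᵀ * Y = 1} X)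
    (k : Fin p) {y : Fin n → ℝ} (hXy : Xᵀ *ᵥ y = 0) (hy : y ⬝ᵥ y = 1) :
    Xᵀ k ⬝ᵥ HXmat L Vion Ld γ X *ᵥ Xᵀ k - 2 * max (specNorm Ld - γ / 3) 0
      ≤ y ⬝ᵥ HXmat L Vion Ld γ X *ᵥ y := by
  have h := second_order_nonneg hL hVion hLd hγ hX hmin k hXy hy
  have hw1 : ∑ i, (X i k * y i) ^ 2 ≤ 1 := by
    rw [← hy, dotProduct]
    refine Finset.sum_le_sum fun i _ => ?_
    have hx : X i k ^ 2 ≤ 1 := (Finset.single_le_sum (f := fun j => X i j ^ 2)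
      (fun _ _ => sq_nonneg _) (Finset.mem_univ k)).trans (rhoX_le_one hX i)
    rw [mul_pow, ← sq]
    exact mul_le_of_le_one_left (sq_nonneg _) hx
  have hw0 : 0 ≤ ∑ i, (X i k * y i) ^ 2 := Finset.sum_nonneg fun _ _ => sq_nonneg _
  have hmax := mul_le_mul_of_nonneg_right (le_max_left (specNorm Ld - γ / 3) 0) hw0
  have hmax' := mul_le_of_le_one_right (le_max_right (specNorm Ld - γ / 3) 0) hw1
  linarith

end localMin

lemma exists_smul_unit {n : ℕ} {y : Fin n → ℝ} (hy : y ≠ 0) :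
    ∃ s : ℝ, ∃ z : Fin n → ℝ, z ⬝ᵥ z = 1 ∧ y = s • z := by
  have hpos : 0 < y ⬝ᵥ y := by simpa using (dotProduct_star_self_pos_iff (v := y)).2 hy
  have hs := Real.sqrt_pos.2 hpos
  refine ⟨√(y ⬝ᵥ y), (√(y ⬝ᵥ y))⁻¹ • y, ?_, ?_⟩
  · rw [smul_dotProduct, dotProduct_smul, smul_eq_mul, smul_eq_mul, ← mul_assoc, ← mul_inv,
      Real.mul_self_sqrt hpos.le, inv_mul_cancel₀ hpos.ne']
  · rw [smul_smul, mul_inv_cancel₀ hs.ne', one_smul]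

/-- It suffices to bound a quadratic form on the unit vectors of a kernel. -/
lemma quadForm_lower_bound_of_unit {n p : ℕ} {X : Matrix (Fin n) (Fin p) ℝ}
    {H : Matrix (Fin n) (Fin n) ℝ} {a : ℝ}
    (h : ∀ z : Fin n → ℝ, Xᵀ *ᵥ z = 0 → z ⬝ᵥ z = 1 → a ≤ z ⬝ᵥ H *ᵥ z)
    (y : Fin n → ℝ) (hXy : Xᵀ *ᵥ y = 0) : a * (y ⬝ᵥ y) ≤ y ⬝ᵥ H *ᵥ y := by
  by_cases hy0 : y = 0
  · simp [hy0]
  obtain ⟨s, z, hz, rfl⟩ := exists_smul_unit hy0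
  have hs : s ≠ 0 := fun hs => hy0 (by rw [hs, zero_smul])
  have hXz : Xᵀ *ᵥ z = 0 := by
    rw [mulVec_smul] at hXy
    exact (smul_eq_zero.1 hXy).resolve_left hs
  have := mul_le_mul_of_nonneg_left (h z hXz hz) (sq_nonneg s)
  simp only [mulVec_smul, smul_dotProduct, dotProduct_smul, smul_eq_mul, hz]
  linarith

/-- Under a spectral gap exceeding `2 * c`, a lower bound by `d k - 2 * c` off an orthonormal
eigenframe improves to `d k`. -/
lemma le_rayleigh_of_gap {n p : ℕ} {q r : Fin n} (hq : p ≤ q + 1) (hr : (r : ℕ) ≤ p)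
    {H : Matrix (Fin n) (Fin n) ℝ}
    (hH : H.IsHermitian) {X : Matrix (Fin n) (Fin p) ℝ} (hX : Xᵀ * X = 1) {d : Fin p → ℝ}
    (hHX : H * X = X * diagonal d) {c : ℝ}
    (hlow : ∀ k, ∀ y : Fin n → ℝ, Xᵀ *ᵥ y = 0 → y ⬝ᵥ y = 1 → d k - 2 * c ≤ y ⬝ᵥ H *ᵥ y)
    (hgap : 2 * c < eig H r - eig H q)
    (k : Fin p) (z : Fin n → ℝ) (hXz : Xᵀ *ᵥ z = 0) (hz : z ⬝ᵥ z = 1) :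
    d k ≤ z ⬝ᵥ H *ᵥ z := by
  have : Nonempty (Fin p) := ⟨k⟩
  obtain ⟨m, hm⟩ := Finite.exists_max d
  refine (hm k).trans ?_
  by_contra! hlt
  have hXX := dotProduct_transpose_of_orthonormal hX
  have hXz' : ∀ j, Xᵀ j ⬝ᵥ z = 0 := fun j => congrFun hXz j
  have hcol : ∀ j, H *ᵥ Xᵀ j = d j • Xᵀ j := fun j => by
    ext i
    have := congrFun (congrFun hHX i) j
    rw [mul_diagonal, mul_comm] at this
    exact this
  have hHt : Hᵀ = H := by rwa [IsHermitian, conjTranspose_eq_transpose_of_trivial] at hH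
  have hXHz : ∀ j, Xᵀ j ⬝ᵥ H *ᵥ z = 0 := fun j => by
    rw [dotProduct_mulVec, ← mulVec_transpose, hHt, hcol, smul_dotProduct, hXz', smul_zero]
  let U : Matrix (Fin n) (Fin p ⊕ Unit) ℝ := (of (Sum.elim Xᵀ fun _ => z))ᵀ
  have hupper : eig H r ≤ d m := by
    refine eig_le_of_compression hH (U := U) (d := Sum.elim d fun _ => z ⬝ᵥ H *ᵥ z) ?_ ?_ ?_ _ ?_
    · ext a b
      change Uᵀ a ⬝ᵥ Uᵀ b = _
      rcases a with a | a <;> rcases b with b | b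
      · exact (hXX a b).trans (by simp [one_apply])
      · exact (hXz' a).trans (by simp)
      · exact (dotProduct_comm _ _).trans ((hXz' b).trans (by simp))
      · exact hz.trans (by simp)
    · rw [Matrix.mul_assoc]
      ext a b
      change Uᵀ a ⬝ᵥ H *ᵥ Uᵀ b = _
      rcases a with a | a <;> rcases b with b | b
      · change Xᵀ a ⬝ᵥ H *ᵥ Xᵀ b = _
        rw [hcol, dotProduct_smul, hXX]
        rcases eq_or_ne a b with rfl | hab
        · simp
        · simp [hab]
      · exact (hXHz a).trans (by simp)
      · change z ⬝ᵥ H *ᵥ Xᵀ b = _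
        rw [hcol, dotProduct_smul, dotProduct_comm, hXz']
        simp
      · change z ⬝ᵥ H *ᵥ z = _
        simp
    · rintro (j | j)
      · exact hm j
      · exact hlt.le
    · simpa using Nat.lt_succ_of_le hr
  have hc : 0 < c := by linarith [hlow m z hXz hz]
  have hlower : d m - 2 * c ≤ eig H q := by
    refine le_eig_of_eigenframe hH hX hHX (quadForm_lower_bound_of_unit (hlow m)) _ ?_
    have := Fintype.card_subtype_lt (p := fun j => d j < d m - 2 * c) (x := m)
      (by linarith)
    rw [Fintype.card_fin] at this
    omega
  linarith

/-- The multiplier equation of a local minimizer. -/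
lemma HXmat_mul_eq {n p : ℕ} {L Vion Ld : Matrix (Fin n) (Fin n) ℝ} {γ : ℝ}
    {X : Matrix (Fin n) (Fin p) ℝ} (hL : L.IsHermitian) (hVion : Vion.IsHermitian)
    (hLd : Ldᵀ = Ld) (hγ : 0 ≤ γ) (hX : Xᵀ * X = 1)
    (hmin : IsLocalMinOn (En L Vion Ld γ) {Y : Matrix (Fin n) (Fin p) ℝ | Yᵀ * Y = 1} X) :
    HXmat L Vion Ld γ X * X = X * (Xᵀ * HXmat L Vion Ld γ X * X) := by
  set H := HXmat L Vion Ld γ X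
  set R := H * X - X * (Xᵀ * H * X) with hR
  have hXR : Xᵀ * R = 0 := by
    rw [hR, Matrix.mul_sub, ← Matrix.mul_assoc Xᵀ X, hX, Matrix.one_mul, Matrix.mul_assoc,
      sub_self]
  have hHX : H * X = R + X * (Xᵀ * H * X) := by simp [hR]
  rw [← sub_eq_zero, ← hR]
  suffices h : ∀ k, Rᵀ k = 0 by
    ext i k
    exact congrFun (h k) i
  intro k
  by_contra hk
  obtain ⟨s, z, hz, hsz⟩ := exists_smul_unit hk
  have hs : s ≠ 0 := fun hs => hk (by rw [hsz, hs, zero_smul])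
  have hXz : Xᵀ *ᵥ z = 0 := by
    have h : Xᵀ *ᵥ Rᵀ k = 0 := by
      ext j
      exact congrFun (congrFun hXR j) k
    rw [hsz, mulVec_smul] at h
    exact (smul_eq_zero.1 h).resolve_left hs
  have hfirst := dotProduct_HXmat_eq_zero hL hVion hLd hγ hX hmin k hXz hz
  have hcol : H *ᵥ Xᵀ k = Rᵀ k + X *ᵥ (Xᵀ * H * X)ᵀ k := by
    ext i
    exact congrFun (congrFun hHX i) k
  rw [show HXmat L Vion Ld γ X = H from rfl, hcol, dotProduct_add, dotProduct_mulVec z X,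
    ← mulVec_transpose, hXz, zero_dotProduct, add_zero, hsz, dotProduct_smul, hz] at hfirst
  exact hs (by simpa using hfirst)

lemma eq_zero_of_rhoX_eq_zero {n p : ℕ} {X : Matrix (Fin n) (Fin p) ℝ} {i : Fin n}
    (hi : rhoX X i = 0) (j : Fin p) : X i j = 0 := by
  have := (Finset.sum_eq_zero_iff_of_nonneg fun _ _ => sq_nonneg _).1 hi j (Finset.mem_univ j)
  exact pow_eq_zero_iff two_ne_zero |>.1 this

lemma sum_subtype_of_support {n : ℕ} {P : Fin n → Prop} [Fintype {i // P i}] {g : Fin n → ℝ}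
    (hg : ∀ i, ¬ P i → g i = 0) : ∑ i : {i // P i}, g i = ∑ i, g i := by
  rw [← Finset.sum_subtype (Finset.univ.filter P) (by simp) g]
  exact Finset.sum_filter_of_ne fun i _ hi => by_contra fun h => hi (hg i h)

/-- A lower bound for a quadratic form off the columns of `X` passes to a principal submatrix. -/
lemma principal_submatrix_lower_bound {n m p : ℕ} {P : Fin n → Prop} (e : {i // P i} ≃ Fin m)
    {H : Matrix (Fin n) (Fin n) ℝ} {X : Matrix (Fin n) (Fin p) ℝ} {a : ℝ}
    (hlow : ∀ y : Fin n → ℝ, Xᵀ *ᵥ y = 0 → a * (y ⬝ᵥ y) ≤ y ⬝ᵥ H *ᵥ y)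
    (y : Fin m → ℝ) (hy : (X.submatrix (fun i => (e.symm i).1) id)ᵀ *ᵥ y = 0) :
    a * (y ⬝ᵥ y) ≤
      y ⬝ᵥ H.submatrix (fun i => (e.symm i).1) (fun i => (e.symm i).1) *ᵥ y := by
  let w : Fin n → ℝ := fun i => if h : P i then y (e ⟨i, h⟩) else 0
  have hw : ∀ i, w (e.symm i).1 = y i := fun i => by
    simp only [w, dif_pos (e.symm i).2, Subtype.coe_eta, Equiv.apply_symm_apply]
  have hsum : ∀ g : Fin n → ℝ, ∑ i, g (e.symm i).1 * y i = ∑ i, g i * w i := fun g => by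
    simp only [← hw]
    rw [e.symm.sum_comp fun i : {i // P i} => g i * w i]
    exact sum_subtype_of_support (g := fun i => g i * w i) fun i hi => by simp [w, hi]
  have hXw : Xᵀ *ᵥ w = 0 := by
    ext j
    exact (hsum fun i => X i j).symm.trans (congrFun hy j)
  have hnorm : y ⬝ᵥ y = w ⬝ᵥ w := by
    rw [dotProduct, dotProduct, ← hsum]
    simp only [hw]
  have hHw : H.submatrix (fun i => (e.symm i).1) (fun i => (e.symm i).1) *ᵥ y
      = fun i => (H *ᵥ w) (e.symm i).1 := by
    ext i
    exact hsum fun j => H (e.symm i).1 j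
  have hq : y ⬝ᵥ H.submatrix (fun i => (e.symm i).1) (fun i => (e.symm i).1) *ᵥ y
      = w ⬝ᵥ H *ᵥ w := by
    rw [hHw, dotProduct_comm, dotProduct_comm w]
    exact hsum _
  rw [hnorm, hq]
  exact hlow w hXw

/-- Theorem 2.5 of the paper: a local minimizer `X*` of the KS total
energy minimization problem with diagonal multiplier `Λ* = (X*)ᵀH(X*)X*` solves the KS
equation restricted to the index set `I* = {i : ρ_i(X*) ≠ 0}`, provided the eigenvalue gap
`λ_{p+1}(H(X*)) − λ_p(H(X*)) ≥ δ > 2(‖L†‖₂ − γ/3)`; moreover the diagonal of `Λ*` consists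
exactly of the `p` smallest eigenvalues of the principal submatrix `H_{I*I*}(X*)`. -/
theorem local_minimizer_solves_KS {n p : ℕ} (hp : 1 ≤ p) (hpn : p < n)
    (L Vion Ld : Matrix (Fin n) (Fin n) ℝ)
    (hL : L.IsHermitian) (hVion : Vion.IsHermitian)
    (hMP1 : L * Ld * L = L) (hMP2 : Ld * L * Ld = Ld)
    (hMP3 : (L * Ld)ᵀ = L * Ld) (hMP4 : (Ld * L)ᵀ = Ld * L)
    (γ : ℝ) (hγ : γ = 2 * (3 / Real.pi) ^ ((1 : ℝ) / 3))
    (X : Matrix (Fin n) (Fin p) ℝ) (hfeas : Xᵀ * X = 1)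
    (hmin : IsLocalMinOn (En L Vion Ld γ) {Y : Matrix (Fin n) (Fin p) ℝ | Yᵀ * Y = 1} X)
    (Λ : Matrix (Fin p) (Fin p) ℝ) (hΛ : Λ = Xᵀ * HXmat L Vion Ld γ X * X)
    (hΛdiag : Λ.IsDiag)
    (δ : ℝ) (hδ : δ > 2 * (specNorm Ld - γ / 3))
    (hgap : eig (HXmat L Vion Ld γ X) ⟨p, hpn⟩
        - eig (HXmat L Vion Ld γ X) ⟨p - 1, by omega⟩ ≥ δ) :
    -- the restricted KS equation and the eigenvalue characterization of `Λ*`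
    (Matrix.of fun (i j : {i : Fin n // rhoX X i ≠ 0}) => HXmat L Vion Ld γ X i.1 j.1) *
        (Matrix.of fun (i : {i : Fin n // rhoX X i ≠ 0}) (j : Fin p) => X i.1 j)
      = (Matrix.of fun (i : {i : Fin n // rhoX X i ≠ 0}) (j : Fin p) => X i.1 j) * Λ ∧
    (Matrix.of fun (i : {i : Fin n // rhoX X i ≠ 0}) (j : Fin p) => X i.1 j)ᵀ *
        (Matrix.of fun (i : {i : Fin n // rhoX X i ≠ 0}) (j : Fin p) => X i.1 j) = 1 ∧
    ∃ hpr : p ≤ Fintype.card {i : Fin n // rhoX X i ≠ 0},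
      Finset.univ.val.map (fun k : Fin p => Λ k k)
        = Finset.univ.val.map (fun k : Fin p =>
            eig (Matrix.reindex (Fintype.equivFin {i : Fin n // rhoX X i ≠ 0})
                  (Fintype.equivFin {i : Fin n // rhoX X i ≠ 0})
                  (Matrix.of fun (i j : {i : Fin n // rhoX X i ≠ 0}) =>
                    HXmat L Vion Ld γ X i.1 j.1))
              (Fin.castLE hpr k)) := by
  have hγ0 : 0 ≤ γ := by rw [hγ]; positivity
  have hLd : Ldᵀ = Ld := transpose_eq_of_moorePenrose
    (by rwa [IsHermitian, conjTranspose_eq_transpose_of_trivial] at hL) hMP1 hMP2 hMP3 hMP4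
  have hHX : HXmat L Vion Ld γ X * X = X * Λ := by
    rw [hΛ]
    exact HXmat_mul_eq hL hVion hLd hγ0 hfeas hmin
  have hH := HXmat_isHermitian hL hVion Ld γ X
  set H := HXmat L Vion Ld γ X
  set d : Fin p → ℝ := fun k => Λ k k with hd
  have hΛd : Λ = diagonal d := hΛdiag.diagonal_diag.symm
  have hdk : ∀ k, Xᵀ k ⬝ᵥ H *ᵥ Xᵀ k = d k := fun k => by
    rw [hd, hΛ, Matrix.mul_assoc]
    rfl
  have hunit : ∀ k, ∀ y : Fin n → ℝ, Xᵀ *ᵥ y = 0 → y ⬝ᵥ y = 1 → d k ≤ y ⬝ᵥ H *ᵥ y := by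
    have hbound : ∀ k, ∀ y : Fin n → ℝ, Xᵀ *ᵥ y = 0 → y ⬝ᵥ y = 1 →
        d k - 2 * max (specNorm Ld - γ / 3) 0 ≤ y ⬝ᵥ H *ᵥ y := fun k y hXy hy => by
      rw [← hdk]
      exact le_rayleigh_of_localMin hL hVion hLd hγ0 hfeas hmin k hXy hy
    rcases le_total (specNorm Ld - γ / 3) 0 with hc | hc
    · simpa [max_eq_right hc] using hbound
    · rw [max_eq_left hc] at hbound
      exact le_rayleigh_of_gap (Nat.sub_add_cancel hp).ge le_rfl hH hfeas (hΛd ▸ hHX) hbound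
        (hδ.lt.trans_le hgap)
  set XI := Matrix.of fun (i : {i : Fin n // rhoX X i ≠ 0}) (j : Fin p) => X i.1 j with hXI
  set HI := Matrix.of fun (i j : {i : Fin n // rhoX X i ≠ 0}) => H i.1 j.1 with hHI
  have hX0 : ∀ i, ¬ rhoX X i ≠ 0 → ∀ j, X i j = 0 := fun i hi =>
    eq_zero_of_rhoX_eq_zero (not_not.1 hi)
  have hKS : HI * XI = XI * Λ := by
    ext i j
    refine Eq.trans ?_ (congrFun (congrFun hHX i.1) j)
    rw [mul_apply, mul_apply]
    exact sum_subtype_of_support (P := fun l => rhoX X l ≠ 0) (g := fun l => H i.1 l * X l j)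
      fun l hl => by simp [hX0 l hl j]
  have hXX : XIᵀ * XI = 1 := by
    rw [← hfeas]
    ext i j
    rw [mul_apply, mul_apply]
    exact sum_subtype_of_support (P := fun l => rhoX X l ≠ 0) (g := fun l => X l i * X l j)
      fun l hl => by simp [hX0 l hl j]
  refine ⟨hKS, hXX, ?_⟩
  set e := Fintype.equivFin {i : Fin n // rhoX X i ≠ 0}
  have hU : (XI.submatrix e.symm id)ᵀ * XI.submatrix e.symm id = 1 := by
    rw [transpose_submatrix, submatrix_mul_equiv, hXX, submatrix_one _ Function.injective_id]
  have hpr := card_le_of_orthonormal_columns hU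
  rw [Fintype.card_fin] at hpr
  refine ⟨hpr, map_eq_map_eig_of_eigenframe (U := XI.submatrix e.symm id) ?_ hU ?_ ?_ hpr⟩
  · exact hH.submatrix fun i => (e.symm i).1
  · rw [reindex_apply, submatrix_mul_equiv, hKS, hΛd]
    rfl
  · exact fun y hy k =>
      principal_submatrix_lower_bound e (quadForm_lower_bound_of_unit (hunit k)) y hy
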